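/- Let σ = (σ_k)_{k≥0} be a left proper or right proper sequence of substitutions σ_k: A_{k+1}* → A_k*. If the level-k language L_σ^(k) is letter-balanced for infinitely many k, then L_σ = L_σ^(0) is factor-balanced. -/

import Mathlib

open List

/-- Number of occurrences of `v` as a factor of `w`, i.e. the number of
decompositions `w = p ++ v ++ s`. -/
def occ {A : Type*} [DecidableEq A] (v w : List A) : ℕ :=
  (List.range (w.length + 1)).countP (fun i => decide (v <+: w.drop i))

/-- Apply a substitution (given by its values on letters) to a word. -/
def applyS {A B : Type*} (σ : A → List B) (w : List A) : List B :=
  (w.map σ).flatten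

/-- A substitution is left proper if all images of letters start with the same
letter (in particular they are nonempty). -/
def LeftProper {A B : Type*} (σ : A → List B) : Prop :=
  ∃ b : B, ∀ a : A, ∃ t : List B, σ a = b :: t

/-- A substitution is right proper if all images of letters end with the same
letter (in particular they are nonempty). -/
def RightProper {A B : Type*} (σ : A → List B) : Prop :=
  ∃ b : B, ∀ a : A, ∃ t : List B, σ a = t ++ [b]

/-- For a sequence of substitutions `σₖ : A_{k+1}* → A_k*`, the composition
`σ_{[k,k+m)} = σ_k ∘ σ_{k+1} ∘ ⋯ ∘ σ_{k+m-1} : A_{k+m}* → A_k*`, on letters. -/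
def seg {A : ℕ → Type*} (σ : ∀ k, A (k + 1) → List (A k)) (k : ℕ) :
    (m : ℕ) → A (k + m) → List (A k)
  | 0, a => [a]
  | m + 1, a => applyS (seg σ k m) (σ (k + m) a)

/-- The language of the sequence `σ` at level `k`: words over `A_k` that are factors
of `σ_{[k,n)}(a)` for some letter `a ∈ A_n`, for infinitely many `n > k`
(written with `n = k + m`, `m > 0`). -/
def LangAt {A : ℕ → Type*}
    (σ : ∀ k, A (k + 1) → List (A k)) (k : ℕ) : Set (List (A k)) :=
  {w | {m : ℕ | 0 < m ∧ ∃ a : A (k + m), w <:+: seg σ k m a}.Infinite}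

section Occurrences

variable {A : Type*} [DecidableEq A]

theorem occ_nil_right (v : List A) : occ v [] = if v = [] then 1 else 0 := by
  by_cases h : v = [] <;> simp [occ, h]

theorem occ_cons (v : List A) (x : A) (w : List A) :
    occ v (x :: w) = (if v <+: x :: w then 1 else 0) + occ v w := by
  unfold occ
  rw [List.length_cons, List.range_succ_eq_map, List.countP_cons, List.countP_map, add_comm]
  simp [Function.comp_def]

theorem occ_concat (v w : List A) (x : A) :
    occ v (w ++ [x]) = occ v w + if v <:+ w ++ [x] then 1 else 0 := by
  induction w with
  | nil =>
    have h : v <+: [x] ↔ v <:+ [x] := by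
      rw [List.prefix_cons_iff, List.suffix_cons_iff]
      simp only [List.prefix_nil, List.suffix_nil]
      constructor
      · rintro (h | ⟨t, h, rfl⟩)
        · exact Or.inr h
        · exact Or.inl h
      · rintro (h | h)
        · exact Or.inr ⟨[], h, rfl⟩
        · exact Or.inl h
    simp [occ_cons, h, add_comm]
  | cons y w ih =>
    have hp : v <+: y :: (w ++ [x]) ↔ v = y :: (w ++ [x]) ∨ v <+: y :: w :=
      List.prefix_concat_iff (l₁ := v) (l₂ := y :: w) (a := x)
    have hs : v <:+ y :: (w ++ [x]) ↔ v = y :: (w ++ [x]) ∨ v <:+ w ++ [x] :=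
      List.suffix_cons_iff
    rw [List.cons_append, occ_cons, occ_cons, ih]
    simp only [hp, hs]
    by_cases h : v = y :: (w ++ [x])
    · have h1 : ¬ v <+: y :: w := fun h' => by
        have := h'.length_le
        simp [h] at this
      have h2 : ¬ v <:+ w ++ [x] := fun h' => by
        have := h'.length_le
        simp [h] at this
      simp only [h1, h2, if_false]
      simp [h]
      omega
    · simp only [h, false_or]
      omega

theorem occ_reverse (v w : List A) : occ v.reverse w.reverse = occ v w := by
  induction w with
  | nil => simp [occ_nil_right]
  | cons x w ih =>
    rw [List.reverse_cons, occ_concat, ih, occ_cons, ← List.reverse_cons, add_comm]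
    simp only [List.reverse_suffix]

theorem occ_singleton (a : A) (w : List A) : occ [a] w = w.count a := by
  induction w with
  | nil => simp [occ_nil_right]
  | cons x w ih =>
    rw [occ_cons, ih, List.count_cons, add_comm]
    by_cases h : a = x
    · simp [h]
    · simp [h, Ne.symm h]

theorem occ_le_occ_append_left (v s w : List A) : occ v w ≤ occ v (s ++ w) := by
  induction s with
  | nil => simp
  | cons x s ih => rw [List.cons_append, occ_cons]; omega

theorem occ_append_left_le (v s w : List A) : occ v (s ++ w) ≤ occ v w + s.length := by
  induction s with
  | nil => simp
  | cons x s ih => rw [List.cons_append, occ_cons, List.length_cons]; split_ifs <;> omega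

theorem occ_le_occ_append_right (v w t : List A) : occ v w ≤ occ v (w ++ t) := by
  rw [← occ_reverse v w, ← occ_reverse v (w ++ t), List.reverse_append]
  exact occ_le_occ_append_left _ _ _

theorem occ_append_right_le (v w t : List A) : occ v (w ++ t) ≤ occ v w + t.length := by
  rw [← occ_reverse v w, ← occ_reverse v (w ++ t), List.reverse_append, ← t.length_reverse]
  exact occ_append_left_le _ _ _

theorem occ_le_of_isInfix (v : List A) {w w' : List A} (h : w <:+: w') :
    occ v w ≤ occ v w' ∧ occ v w' + w.length ≤ occ v w + w'.length := by
  obtain ⟨s, t, rfl⟩ := h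
  have h1 := occ_le_occ_append_left v s w
  have h2 := occ_append_left_le v s w
  have h3 := occ_le_occ_append_right v (s ++ w) t
  have h4 := occ_append_right_le v (s ++ w) t
  simp only [List.length_append]
  omega

/-- The number of occurrences of `v` in `s ++ x` starting inside `s` depends on `x` only through
a prefix of length at least `v.length`. -/
theorem occ_append_of_isPrefix {v q x : List A} (hv : v.length ≤ q.length) (hq : q <+: x)
    (s : List A) : occ v (s ++ x) + occ v q = occ v (s ++ q) + occ v x := by
  induction s with
  | nil => simp [add_comm]
  | cons y s ih =>
    have h : v <+: y :: (s ++ x) ↔ v <+: y :: (s ++ q) := by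
      have hpre : y :: (s ++ q) <+: y :: (s ++ x) := by
        obtain ⟨r, rfl⟩ := hq
        exact ⟨r, by simp⟩
      constructor
      · intro h
        refine List.prefix_of_prefix_length_le h hpre ?_
        simp only [List.length_cons, List.length_append]
        omega
      · exact fun h => h.trans hpre
    simp only [List.cons_append, occ_cons, h]
    omega

theorem abs_sum_map_sub_le [Fintype A] {C : ℕ} {x y : List A}
    (h : ∀ a, |(occ [a] x : ℤ) - (occ [a] y : ℤ)| ≤ (C : ℤ)) (f : A → ℤ) (B : A → ℕ)
    (hf : ∀ a, |f a| ≤ (B a : ℤ)) :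
    |(x.map f).sum - (y.map f).sum| ≤ ((C * ∑ a, B a : ℕ) : ℤ) := by
  have key : ∀ z : List A, (z.map f).sum = ∑ a, (occ [a] z : ℤ) * f a := by
    intro z
    simp only [occ_singleton]
    induction z with
    | nil => simp
    | cons b z ih =>
      simp only [List.map_cons, List.sum_cons, ih, List.count_cons, Nat.cast_add, add_mul,
        Finset.sum_add_distrib]
      simp [add_comm]
  rw [key, key, ← Finset.sum_sub_distrib]
  refine (Finset.abs_sum_le_sum_abs _ _).trans ?_
  push_cast
  rw [Finset.mul_sum]
  refine Finset.sum_le_sum fun a _ => ?_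
  rw [← sub_mul, abs_mul]
  exact mul_le_mul (h a) (hf a) (abs_nonneg _) (by positivity)

end Occurrences

section Substitutions

variable {A B D : Type*}

@[simp] theorem applyS_nil (τ : A → List B) : applyS τ [] = [] := rfl

@[simp] theorem applyS_cons (τ : A → List B) (a : A) (w : List A) :
    applyS τ (a :: w) = τ a ++ applyS τ w := by
  simp [applyS]

@[simp] theorem applyS_append (τ : A → List B) (w w' : List A) :
    applyS τ (w ++ w') = applyS τ w ++ applyS τ w' := by
  simp [applyS]

theorem applyS_applyS (τ : B → List D) (ρ : A → List B) (w : List A) :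
    applyS τ (applyS ρ w) = applyS (fun a => applyS τ (ρ a)) w := by
  induction w with
  | nil => rfl
  | cons a w ih => simp [ih]

theorem applyS_singleton (w : List A) : applyS (fun a => [a]) w = w := by
  induction w with
  | nil => rfl
  | cons a w ih => simp [ih]

theorem applyS_isInfix (τ : A → List B) {w w' : List A} (h : w <:+: w') :
    applyS τ w <:+: applyS τ w' := by
  obtain ⟨s, t, rfl⟩ := h
  exact ⟨applyS τ s, applyS τ t, by simp⟩

theorem applyS_reverse (τ : A → List B) (w : List A) :
    applyS (fun a => (τ a).reverse) w.reverse = (applyS τ w).reverse := by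
  induction w with
  | nil => rfl
  | cons a w ih => simp [ih]

theorem length_applyS (τ : A → List B) (w : List A) :
    ((applyS τ w).length : ℤ) = (w.map fun a => ((τ a).length : ℤ)).sum := by
  induction w with
  | nil => rfl
  | cons a w ih => simp [ih]

theorem length_le_length_applyS {τ : A → List B} (hτ : ∀ a, τ a ≠ []) (w : List A) :
    w.length ≤ (applyS τ w).length := by
  induction w with
  | nil => simp
  | cons a w ih =>
    have := List.length_pos_of_ne_nil (hτ a)
    simp only [applyS_cons, List.length_cons, List.length_append]
    omega

theorem exists_prefix_applyS {τ : A → List B} {S : ℕ} (hS : ∀ a, (τ a).length ≤ S)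
    (x : List A) : ∀ w : List B, w <+: applyS τ x →
      ∃ y, y <+: x ∧ w <+: applyS τ y ∧ (applyS τ y).length ≤ w.length + S := by
  induction x with
  | nil => exact fun w h => ⟨[], List.prefix_rfl, h, by simp⟩
  | cons a x ih =>
    intro w h
    rw [applyS_cons] at h
    by_cases hl : w.length ≤ (τ a).length
    · refine ⟨[a], ⟨x, rfl⟩, ?_, ?_⟩
      · simpa using List.prefix_of_prefix_length_le h (List.prefix_append _ _) hl
      · have := hS a
        simp
        omega
    · obtain ⟨w', rfl⟩ : τ a <+: w :=
        List.prefix_of_prefix_length_le (List.prefix_append _ _) h (by omega)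
      obtain ⟨y, hy, hw, hlen⟩ := ih w' ((List.prefix_append_right_inj _).1 h)
      refine ⟨a :: y, ?_, ?_, ?_⟩
      · exact (List.prefix_cons_inj a).2 hy
      · simpa using hw
      · simp only [applyS_cons, List.length_append]
        omega

theorem exists_infix_applyS {τ : A → List B} {S : ℕ} (hS : ∀ a, (τ a).length ≤ S)
    (x : List A) (w : List B) (h : w <:+: applyS τ x) :
      ∃ y, y <:+: x ∧ w <:+: applyS τ y ∧ (applyS τ y).length ≤ w.length + 2 * S := by
  induction x with
  | nil => exact ⟨[], List.infix_rfl, h, by simp⟩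
  | cons a x ih =>
    obtain ⟨s, t, hst⟩ := h
    by_cases hl : (τ a).length ≤ s.length
    · have hpre : τ a <+: s := by
        refine List.prefix_of_prefix_length_le (l₃ := applyS τ (a :: x)) ?_ ?_ hl
        · simp
        · exact ⟨w ++ t, by simpa using hst⟩
      obtain ⟨s', rfl⟩ := hpre
      have : w <:+: applyS τ x := ⟨s', t, by simpa using hst⟩
      obtain ⟨y, hy, hw, hlen⟩ := ih this
      exact ⟨y, hy.trans (List.suffix_cons a x).isInfix, hw, hlen⟩
    · obtain ⟨y, hy, hw, hlen⟩ := exists_prefix_applyS hS (a :: x) (s ++ w) ⟨t, hst⟩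
      refine ⟨y, hy.isInfix, (List.suffix_append s w).isInfix.trans hw.isInfix, ?_⟩
      have := hS a
      rw [List.length_append] at hlen
      omega

theorem prefix_applyS_append {τ : A → List B} {q : List B} (h : ∀ a, q <+: τ a ++ q)
    (w : List A) : q <+: applyS τ w ++ q := by
  induction w with
  | nil => simp
  | cons a w ih =>
    rw [applyS_cons, List.append_assoc]
    exact (h a).trans ((List.prefix_append_right_inj _).2 ih)

theorem occ_applyS_append [DecidableEq B] {τ : A → List B} {q v : List B}
    (h : ∀ a, q <+: τ a ++ q) (hv : v.length ≤ q.length) (w : List A) :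
    (occ v (applyS τ w ++ q) : ℤ) =
      occ v q + (w.map fun a => (occ v (τ a ++ q) : ℤ) - occ v q).sum := by
  induction w with
  | nil => simp
  | cons a w ih =>
    have := occ_append_of_isPrefix hv (prefix_applyS_append h w) (τ a)
    rw [applyS_cons, List.append_assoc, List.map_cons, List.sum_cons]
    omega

end Substitutions

section Sequences

variable {A : ℕ → Type*} (σ : ∀ k, A (k + 1) → List (A k))

/-- The composition `σ_0 ∘ ⋯ ∘ σ_{n-1}` on letters of level `n`. -/
def toBase : (n : ℕ) → A n → List (A 0)
  | 0, a => [a]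
  | n + 1, a => applyS (toBase n) (σ n a)

theorem toBase_add (k m : ℕ) (a : A (k + m)) :
    toBase σ (k + m) a = applyS (toBase σ k) (seg σ k m a) := by
  induction m with
  | zero => simp [seg]
  | succ m ih =>
    change applyS (toBase σ (k + m)) (σ (k + m) a) =
      applyS (toBase σ k) (applyS (seg σ k m) (σ (k + m) a))
    rw [applyS_applyS]
    congr 1
    exact funext ih

theorem seg_zero_eq_toBase (m : ℕ) (a : A (0 + m)) : seg σ 0 m a = toBase σ (0 + m) a := by
  rw [toBase_add]
  exact (applyS_singleton _).symm

theorem applyS_congr_level {X : Type*} {n n' : ℕ} (h : n = n') {f : A n → List X}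
    {g : A n' → List X} (hfg : ∀ a a', HEq a a' → f a = g a') {a : A (n + 1)} {a' : A (n' + 1)}
    (ha : HEq a a') : applyS f (σ n a) = applyS g (σ n' a') := by
  subst h
  obtain rfl : f = g := funext fun a => hfg a a HEq.rfl
  rw [eq_of_heq ha]

theorem seg_add (k m l : ℕ) : ∀ (a : A (k + m + l)) (a' : A (k + (m + l))), HEq a a' →
    applyS (seg σ k m) (seg σ (k + m) l a) = seg σ k (m + l) a' := by
  induction l with
  | zero =>
    intro a a' h
    rw [← eq_of_heq h]
    simp [seg]
  | succ l ih =>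
    intro a a' h
    change applyS (seg σ k m) (applyS (seg σ (k + m) l) (σ (k + m + l) a)) =
      applyS (seg σ k (m + l)) (σ (k + (m + l)) a')
    rw [applyS_applyS]
    exact applyS_congr_level σ (Nat.add_assoc k m l) ih h

theorem applyS_seg_mem_LangAt {k m : ℕ} {y : List (A (k + m))} (hy : y ∈ LangAt σ (k + m)) :
    applyS (seg σ k m) y ∈ LangAt σ k := by
  have hinj : Function.Injective (m + ·) := add_right_injective m
  refine (Set.Infinite.image hinj.injOn hy).mono ?_
  rintro _ ⟨l, ⟨hl, a, ha⟩, rfl⟩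
  have hA : A (k + m + l) = A (k + (m + l)) := by rw [Nat.add_assoc]
  refine ⟨by simp only; omega, cast hA a, ?_⟩
  rw [← seg_add σ k m l a (cast hA a) (cast_heq hA a).symm]
  exact applyS_isInfix _ ha

theorem mem_LangAt_of_isInfix {k : ℕ} {w w' : List (A k)} (h : w <:+: w') (hw : w' ∈ LangAt σ k) :
    w ∈ LangAt σ k := by
  refine Set.Infinite.mono ?_ hw
  rintro m ⟨hm, a, ha⟩
  exact ⟨hm, a, h.trans ha⟩

theorem exists_mem_LangAt_infix_toBase [∀ k, Fintype (A k)] {j : ℕ}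
    (hj : ∀ a, toBase σ j a ≠ []) {w : List (A 0)} (hw : w ∈ LangAt σ 0) :
    ∃ y ∈ LangAt σ j, w <:+: applyS (toBase σ j) y ∧
      (applyS (toBase σ j) y).length ≤ w.length + 2 * ∑ a, (toBase σ j a).length := by
  have hS : ∀ a, (toBase σ j a).length ≤ ∑ a, (toBase σ j a).length := fun a =>
    Finset.single_le_sum (f := fun a => (toBase σ j a).length) (fun _ _ => Nat.zero_le _)
      (Finset.mem_univ a)
  set S := ∑ a, (toBase σ j a).length
  by_contra! hcon
  let Y : Set (List (A j)) := {y | y.length ≤ w.length + 2 * S ∧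
    w <:+: applyS (toBase σ j) y ∧ (applyS (toBase σ j) y).length ≤ w.length + 2 * S}
  have hY : Y.Finite := (List.finite_length_le (A j) (w.length + 2 * S)).subset fun y hy => hy.1
  have hE : ∀ y ∈ Y, {l : ℕ | 0 < l ∧ ∃ a : A (j + l), y <:+: seg σ j l a}.Finite := by
    intro y hy
    by_contra hinf
    exact absurd hy.2.2 (not_le.2 (hcon y hinf hy.2.1))
  refine hw (((Set.finite_Iic j).union
    (hY.biUnion fun y hy => (hE y hy).image (j + ·))).subset ?_)
  rintro n ⟨-, a, ha⟩
  rw [seg_zero_eq_toBase] at ha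
  have hn : ∃ a : A n, w <:+: toBase σ n a := by
    have : ∃ a : A (0 + n), w <:+: toBase σ (0 + n) a := ⟨a, ha⟩
    rwa [Nat.zero_add] at this
  rcases le_or_gt n j with h | h
  · exact Or.inl h
  right
  obtain ⟨l, rfl⟩ := Nat.exists_eq_add_of_le h.le
  obtain ⟨b, hb⟩ := hn
  rw [toBase_add] at hb
  obtain ⟨y, hy, hwy, hlen⟩ := exists_infix_applyS hS _ w hb
  refine Set.mem_biUnion (x := y) ⟨(length_le_length_applyS hj y).trans hlen, hwy, hlen⟩ ?_
  exact ⟨l, ⟨by omega, b, hy⟩, rfl⟩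

theorem toBase_add_ne_nil {k m : ℕ} (hk : ∀ a, toBase σ k a ≠ [])
    (hm : LeftProper (seg σ k m)) (a : A (k + m)) : toBase σ (k + m) a ≠ [] := by
  obtain ⟨b, hb⟩ := hm
  obtain ⟨t, ht⟩ := hb a
  rw [toBase_add, ht, applyS_cons]
  simp [hk b]

theorem exists_le_toBase_ne_nil (hσ : ∀ k, ∃ m, 0 < m ∧ LeftProper (seg σ k m)) (n : ℕ) :
    ∃ k, n ≤ k ∧ ∀ a, toBase σ k a ≠ [] := by
  induction n with
  | zero => exact ⟨0, le_rfl, fun a => by simp [toBase]⟩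
  | succ n ih =>
    obtain ⟨k, hk, hne⟩ := ih
    obtain ⟨m, hm, hp⟩ := hσ k
    exact ⟨k + m, by omega, toBase_add_ne_nil σ hne hp⟩

/-- Left properness yields arbitrarily long words `q` that are prefixes of `τ(a) q` for every
letter `a` and every sufficiently long composition `τ`. -/
theorem exists_prefix_toBase_append (hσ : ∀ k, ∃ m, 0 < m ∧ LeftProper (seg σ k m)) (n : ℕ)
    [∀ k, Nonempty (A k)] :
    ∃ k, (∀ a, toBase σ k a ≠ []) ∧
      ∃ q : List (A 0), n ≤ q.length ∧ ∀ a, q <+: toBase σ k a ++ q := by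
  induction n with
  | zero => exact ⟨0, fun a => by simp [toBase], [], by simp, by simp⟩
  | succ n ih =>
    obtain ⟨k, hne, q, hq, hpre⟩ := ih
    obtain ⟨m, -, hp⟩ := hσ k
    refine ⟨k + m, toBase_add_ne_nil σ hne hp, ?_⟩
    obtain ⟨b, hb⟩ := hp
    refine ⟨toBase σ k b ++ q, ?_, fun a => ?_⟩
    · have := List.length_pos_of_ne_nil (hne b)
      rw [List.length_append]
      omega
    · obtain ⟨t, ht⟩ := hb a
      rw [toBase_add, ht, applyS_cons, List.append_assoc]
      refine (List.prefix_append_right_inj _).2 ?_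
      simpa using prefix_applyS_append hpre (t ++ [b])

theorem factor_balanced_of_left_proper [∀ k, Fintype (A k)] [∀ k, DecidableEq (A k)]
    (hσ : ∀ k : ℕ, ∃ m : ℕ, 0 < m ∧ LeftProper (seg σ k m))
    (hbal : {k : ℕ | ∃ C : ℕ, ∀ a : A k, ∀ w ∈ LangAt σ k, ∀ w' ∈ LangAt σ k,
      w.length = w'.length →
        |(occ [a] w : ℤ) - (occ [a] w' : ℤ)| ≤ (C : ℤ)}.Infinite) (n : ℕ) :
    ∃ C : ℕ, ∀ v : List (A 0), v.length = n →
      ∀ w ∈ LangAt σ 0, ∀ w' ∈ LangAt σ 0, w.length = w'.length →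
        |(occ v w : ℤ) - (occ v w' : ℤ)| ≤ (C : ℤ) := by
  have : ∀ k, Nonempty (A k) := fun k => let ⟨_, _, b, _⟩ := hσ k; ⟨b⟩
  obtain ⟨k₀, -, q, hq, hpre₀⟩ := exists_prefix_toBase_append σ hσ n
  obtain ⟨k, ⟨C, hC⟩, hk⟩ := hbal.exists_gt k₀
  have hpre : ∀ a, q <+: toBase σ k a ++ q := by
    obtain ⟨m, rfl⟩ := Nat.exists_eq_add_of_le hk.le
    intro a
    rw [toBase_add]
    exact prefix_applyS_append hpre₀ _
  obtain ⟨j, hj, hne⟩ := exists_le_toBase_ne_nil σ hσ k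
  obtain ⟨m, rfl⟩ := Nat.exists_eq_add_of_le hj
  set D := 2 * ∑ a, (toBase σ (k + m) a).length with hD
  have hcover : ∀ w ∈ LangAt σ 0, ∃ u ∈ LangAt σ k, w <:+: applyS (toBase σ k) u ∧
      (applyS (toBase σ k) u).length ≤ w.length + D := by
    intro w hw
    obtain ⟨y, hy, hwy, hlen⟩ := exists_mem_LangAt_infix_toBase σ hne hw
    refine ⟨_, applyS_seg_mem_LangAt σ hy, ?_⟩
    have h : applyS (toBase σ k) (applyS (seg σ k m) y) = applyS (toBase σ (k + m)) y := by
      rw [applyS_applyS]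
      congr 1
      exact (funext (toBase_add σ k m)).symm
    rw [h]
    exact ⟨hwy, hlen⟩
  set E := C * ∑ a, (toBase σ k a).length with hE
  refine ⟨2 * D + 2 * E + 2 * q.length, fun v hv => ?_⟩
  have main : ∀ w w' : List (A 0), w.length = w'.length → ∀ u ∈ LangAt σ k, ∀ u' ∈ LangAt σ k,
      u.length ≤ u'.length →
      w <:+: applyS (toBase σ k) u → (applyS (toBase σ k) u).length ≤ w.length + D →
      w' <:+: applyS (toBase σ k) u' → (applyS (toBase σ k) u').length ≤ w'.length + D →
      |(occ v w : ℤ) - (occ v w' : ℤ)| ≤ ((2 * D + 2 * E + 2 * q.length : ℕ) : ℤ) := by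
    intro w w' hww u hu u' hu' huu hw hwlen hw' hwlen'
    obtain ⟨u₁, r, rfl, hlen⟩ : ∃ u₁ r, u' = u₁ ++ r ∧ u.length = u₁.length :=
      ⟨u'.take u.length, u'.drop u.length, (List.take_append_drop _ _).symm, by simp [huu]⟩
    have hu₁ : u₁ ∈ LangAt σ k := mem_LangAt_of_isInfix σ (List.prefix_append u₁ r).isInfix hu'
    have hcount := fun a => hC a u hu u₁ hu₁ hlen
    have hL := abs_sum_map_sub_le hcount (fun a => ((toBase σ k a).length : ℤ))
      (fun a => (toBase σ k a).length) (fun a => by simp)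
    have hF := abs_sum_map_sub_le hcount
      (fun a => (occ v (toBase σ k a ++ q) : ℤ) - occ v q)
      (fun a => (toBase σ k a).length) (fun a => by
        have h1 := occ_le_occ_append_left v (toBase σ k a) q
        have h2 := occ_append_left_le v (toBase σ k a) q
        rw [abs_le]
        omega)
    rw [← length_applyS, ← length_applyS, ← hE, abs_le] at hL
    rw [← hE, abs_le] at hF
    have hv' : v.length ≤ q.length := by omega
    have hu_add := occ_applyS_append hpre hv' u
    have hu₁_add := occ_applyS_append hpre hv' u₁
    have h1 := occ_le_of_isInfix v hw
    have h2 := occ_le_of_isInfix v hw'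
    have h3 := hw.length_le
    have h4 := hw'.length_le
    rw [applyS_append] at h2 h4 hwlen'
    have h5 := occ_le_occ_append_right v (applyS (toBase σ k) u₁) (applyS (toBase σ k) r)
    have h6 := occ_append_right_le v (applyS (toBase σ k) u₁) (applyS (toBase σ k) r)
    have h7 := occ_le_occ_append_right v (applyS (toBase σ k) u₁) q
    have h8 := occ_append_right_le v (applyS (toBase σ k) u₁) q
    have h9 := occ_le_occ_append_right v (applyS (toBase σ k) u) q
    have h10 := occ_append_right_le v (applyS (toBase σ k) u) q
    rw [List.length_append] at h2 h4 hwlen'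
    rw [abs_le]
    push_cast
    constructor <;> omega
  intro w hw w' hw' hww
  obtain ⟨u, hu, hwu, hlen⟩ := hcover w hw
  obtain ⟨u', hu', hwu', hlen'⟩ := hcover w' hw'
  rcases le_total u.length u'.length with h | h
  · exact main w w' hww u hu u' hu' h hwu hlen hwu' hlen'
  · rw [abs_sub_comm]
    exact main w' w hww.symm u' hu' u hu h hwu' hlen' hwu hlen

theorem seg_reverse (k m : ℕ) (a : A (k + m)) :
    seg (fun k a => (σ k a).reverse) k m a = (seg σ k m a).reverse := by
  induction m with
  | zero => rfl
  | succ m ih =>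
    change applyS (seg (fun k a => (σ k a).reverse) k m) (σ (k + m) a).reverse =
      (applyS (seg σ k m) (σ (k + m) a)).reverse
    rw [funext ih, applyS_reverse]

theorem mem_LangAt_reverse_iff {k : ℕ} {w : List (A k)} :
    w ∈ LangAt (fun k a => (σ k a).reverse) k ↔ w.reverse ∈ LangAt σ k := by
  have h : ∀ m (a : A (k + m)), w <:+: (seg σ k m a).reverse ↔ w.reverse <:+: seg σ k m a :=
    fun m a => by rw [← List.reverse_infix, List.reverse_reverse]
  simp only [LangAt, Set.mem_ofPred_eq, seg_reverse, h]

end Sequences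

/-- for a left proper or right proper sequence of substitutions, if
the level-`k` language is letter-balanced for infinitely many `k`, then the
language `L_σ = L_σ^(0)` is factor-balanced. -/
theorem factor_balanced_of_proper_sadic {A : ℕ → Type*}
    [∀ k, Fintype (A k)] [∀ k, DecidableEq (A k)]
    (σ : ∀ k, A (k + 1) → List (A k))
    (hproper : (∀ k : ℕ, ∃ m : ℕ, 0 < m ∧ LeftProper (seg σ k m)) ∨
               (∀ k : ℕ, ∃ m : ℕ, 0 < m ∧ RightProper (seg σ k m)))
    (hbal : {k : ℕ | ∃ C : ℕ, ∀ a : A k, ∀ w ∈ LangAt σ k, ∀ w' ∈ LangAt σ k,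
      w.length = w'.length →
        |(occ [a] w : ℤ) - (occ [a] w' : ℤ)| ≤ (C : ℤ)}.Infinite) :
    ∀ n : ℕ, 1 ≤ n → ∃ C : ℕ, ∀ v : List (A 0), v.length = n →
      ∀ w ∈ LangAt σ 0, ∀ w' ∈ LangAt σ 0, w.length = w'.length →
        |(occ v w : ℤ) - (occ v w' : ℤ)| ≤ (C : ℤ) := by
  intro n _
  rcases hproper with hσ | hσ
  · exact factor_balanced_of_left_proper σ hσ hbal n
  · have hσ' : ∀ k, ∃ m, 0 < m ∧ LeftProper (seg (fun k a => (σ k a).reverse) k m) := by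
      intro k
      obtain ⟨m, hm, b, hb⟩ := hσ k
      refine ⟨m, hm, b, fun a => ?_⟩
      obtain ⟨t, ht⟩ := hb a
      exact ⟨t.reverse, by rw [seg_reverse, ht]; simp⟩
    obtain ⟨C, hC⟩ := by
      refine factor_balanced_of_left_proper (fun k a => (σ k a).reverse) hσ' (hbal.mono ?_) n
      rintro k ⟨C, hC⟩
      refine ⟨C, fun a w hw w' hw' hlen => ?_⟩
      have := hC a _ ((mem_LangAt_reverse_iff σ).1 hw) _ ((mem_LangAt_reverse_iff σ).1 hw')
        (by simpa using hlen)
      simpa only [occ_singleton, List.count_reverse] using this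
    refine ⟨C, fun v hv w hw w' hw' hlen => ?_⟩
    have := hC v.reverse (by simpa using hv) w.reverse
      ((mem_LangAt_reverse_iff σ).2 (by simpa using hw)) w'.reverse
      ((mem_LangAt_reverse_iff σ).2 (by simpa using hw')) (by simpa using hlen)
    rwa [occ_reverse, occ_reverse] at this
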